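/- Define F(s) = ζ(s) - ψ(1-s) for real s ∈ (0,1). Then F is strictly increasing on (0,1), i.e., F'(s) > 0 for all s ∈ (0,1). -/

import Mathlib

/-- The real digamma function `ψ = Γ'/Γ`. -/
noncomputable def digammaReal (x : ℝ) : ℝ := deriv Real.Gamma x / Real.Gamma x

/-- `F(s) = ζ(s) - ψ(1-s)` for real `s`. -/
noncomputable def F (s : ℝ) : ℝ := (riemannZeta s).re - digammaReal (1 - s)

open Set Filter Topology MeasureTheory

theorem differentiableAt_digammaReal {x : ℝ} (hx : 0 < x) : DifferentiableAt ℝ digammaReal x := by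
  have hne : ∀ m : ℕ, x ≠ -m := fun m => by
    have : (0 : ℝ) ≤ m := m.cast_nonneg
    linarith
  have hC : AnalyticAt ℂ Complex.Gamma (x : ℂ) := by
    have hU : IsOpen {z : ℂ | 0 < z.re} := isOpen_lt continuous_const Complex.continuous_re
    have hd : DifferentiableOn ℂ Complex.Gamma {z : ℂ | 0 < z.re} := fun z hz =>
      (Complex.differentiableAt_Gamma z fun m h => by
        have : (0 : ℝ) ≤ m := m.cast_nonneg
        have h2 := congrArg Complex.re h
        simp only [Complex.neg_re, Complex.natCast_re] at h2
        simp only [mem_ofPred_eq] at hz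
        linarith).differentiableWithinAt
    exact hd.analyticAt (hU.mem_nhds (by simpa using hx))
  have hR : AnalyticAt ℝ Real.Gamma x := hC.re_ofReal
  have h1 : DifferentiableAt ℝ (deriv Real.Gamma) x := hR.deriv.differentiableAt
  exact h1.div (Real.differentiableAt_Gamma hne) (Real.Gamma_pos_of_pos hx).ne'

theorem deriv_log_comp_Gamma {x : ℝ} (hx : 0 < x) :
    deriv (Real.log ∘ Real.Gamma) x = digammaReal x := by
  have hd : DifferentiableAt ℝ Real.Gamma x :=
    Real.differentiableOn_Gamma_Ioi.differentiableAt (Ioi_mem_nhds hx)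
  exact deriv.log hd (Real.Gamma_pos_of_pos hx).ne'

theorem monotoneOn_digammaReal : MonotoneOn digammaReal (Ioi 0) := by
  have h := Real.convexOn_log_Gamma.monotoneOn_deriv fun x hx =>
    (Real.differentiableOn_Gamma_Ioi.differentiableAt (Ioi_mem_nhds hx)).log
      (Real.Gamma_pos_of_pos hx).ne'
  exact h.congr fun x hx => deriv_log_comp_Gamma hx

theorem deriv_digammaReal_nonneg {x : ℝ} (hx : 0 < x) : 0 ≤ deriv digammaReal x := by
  have h := monotoneOn_digammaReal.derivWithin_nonneg (x := x)
  rwa [derivWithin_of_isOpen isOpen_Ioi hx] at h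

theorem digammaReal_add_one {x : ℝ} (hx : 0 < x) :
    digammaReal (x + 1) = digammaReal x + 1 / x := by
  have hG := (Real.Gamma_pos_of_pos hx).ne'
  have hd : DifferentiableAt ℝ Real.Gamma x :=
    Real.differentiableOn_Gamma_Ioi.differentiableAt (Ioi_mem_nhds hx)
  have h : deriv Real.Gamma (x + 1) = Real.Gamma x + x * deriv Real.Gamma x := by
    rw [← deriv_comp_add_const]
    have he : (fun y => Real.Gamma (y + 1)) =ᶠ[𝓝 x] fun y => y * Real.Gamma y := by
      filter_upwards [Ioi_mem_nhds hx] with y hy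
      exact Real.Gamma_add_one (ne_of_gt hy)
    rw [he.deriv_eq]
    simpa using ((hasDerivAt_id' x).fun_mul hd.hasDerivAt).deriv
  rw [digammaReal, digammaReal, h, Real.Gamma_add_one hx.ne']
  field_simp
  ring
/-- The kernel `{t}(1-{t})/2` on `t > 1`, extended by zero. -/
noncomputable def bernoulliKernel : ℝ → ℂ :=
  (Ioi 1).indicator fun t => ((Int.fract t * (1 - Int.fract t) / 2 : ℝ) : ℂ)

theorem norm_bernoulliKernel_le (t : ℝ) : ‖bernoulliKernel t‖ ≤ 1 / 8 := by
  rw [bernoulliKernel]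
  refine (norm_indicator_le_norm_self _ _).trans ?_
  rw [Complex.norm_real, Real.norm_eq_abs, abs_le]
  have h0 := Int.fract_nonneg t
  have h1 := (Int.fract_lt_one t).le
  constructor <;> nlinarith [sq_nonneg (Int.fract t - 1 / 2), mul_nonneg h0 (sub_nonneg.2 h1)]

theorem measurable_bernoulliKernel : Measurable bernoulliKernel := by
  unfold bernoulliKernel
  refine Measurable.indicator ?_ measurableSet_Ioi
  fun_prop

theorem locallyIntegrableOn_bernoulliKernel :
    LocallyIntegrableOn bernoulliKernel (Ioi 0) := by
  refine LocallyIntegrable.locallyIntegrableOn ?_ _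
  refine (locallyIntegrable_const (1 / 8 : ℝ)).mono
    measurable_bernoulliKernel.aestronglyMeasurable ?_
  filter_upwards with t
  simpa using norm_bernoulliKernel_le t

theorem mellin_bernoulliKernel {z : ℂ} (hz : z.re < 0) :
    MellinConvergent (fun t => Real.log t • bernoulliKernel t) z ∧
      HasDerivAt (mellin bernoulliKernel)
        (mellin (fun t => Real.log t • bernoulliKernel t) z) z := by
  refine mellin_hasDerivAt_of_isBigO_rpow (a := 0) (b := z.re - 1)
    locallyIntegrableOn_bernoulliKernel ?_ hz ?_ (by linarith)
  · refine Asymptotics.IsBigO.of_bound (1 / 8) ?_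
    filter_upwards with t
    simpa using norm_bernoulliKernel_le t
  · refine Asymptotics.IsBigO.of_bound 0 ?_
    filter_upwards [mem_nhdsWithin_of_mem_nhds (Iio_mem_nhds (zero_lt_one' ℝ))] with t ht
    simp [bernoulliKernel, not_lt.2 (le_of_lt (mem_Iio.1 ht))]

theorem mellinConvergent_bernoulliKernel {z : ℂ} (hz : z.re < 0) :
    MellinConvergent bernoulliKernel z := by
  refine mellinConvergent_of_isBigO_rpow (a := 0) (b := z.re - 1)
    locallyIntegrableOn_bernoulliKernel ?_ hz ?_ (by linarith)
  · refine Asymptotics.IsBigO.of_bound (1 / 8) ?_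
    filter_upwards with t
    simpa using norm_bernoulliKernel_le t
  · refine Asymptotics.IsBigO.of_bound 0 ?_
    filter_upwards [mem_nhdsWithin_of_mem_nhds (Iio_mem_nhds (zero_lt_one' ℝ))] with t ht
    simp [bernoulliKernel, not_lt.2 (le_of_lt (mem_Iio.1 ht))]

theorem re_mellin_bernoulliKernel_nonneg (x : ℝ) : 0 ≤ (mellin bernoulliKernel x).re := by
  have h : mellin bernoulliKernel x = ((∫ t in Ioi (0 : ℝ), t ^ (x - 1) *
      (Ioi 1).indicator (fun t => Int.fract t * (1 - Int.fract t) / 2) t : ℝ) : ℂ) := by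
    rw [mellin, ← integral_complex_ofReal]
    refine setIntegral_congr_fun measurableSet_Ioi fun t ht => ?_
    have h0 : (0 : ℝ) ≤ t := le_of_lt ht
    simp only [bernoulliKernel, indicator_apply, smul_eq_mul]
    split_ifs <;> simp [Complex.ofReal_cpow h0]
  rw [h, Complex.ofReal_re]
  refine setIntegral_nonneg measurableSet_Ioi fun t ht => ?_
  refine mul_nonneg (Real.rpow_nonneg (le_of_lt ht) _) (indicator_nonneg (fun u _ => ?_) _)
  have h0 := Int.fract_nonneg u
  have h1 := sub_nonneg.2 (Int.fract_lt_one u).le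
  positivity

theorem norm_mellin_log_smul_bernoulliKernel_le {x : ℝ} (hx : x < 0) :
    ‖mellin (fun t => Real.log t • bernoulliKernel t) x‖ ≤ 1 / (2 * x ^ 2) := by
  have hi : IntegrableOn (fun t : ℝ => 1 / 8 * (2 / -x) * t ^ (x / 2 - 1)) (Ioi 1) :=
    (integrableOn_Ioi_rpow_of_lt (by linarith) one_pos).const_mul _
  have hv : ∫ t in Ioi (0 : ℝ), (Ioi 1).indicator
      (fun t : ℝ => 1 / 8 * (2 / -x) * t ^ (x / 2 - 1)) t = 1 / (2 * x ^ 2) := by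
    rw [setIntegral_indicator measurableSet_Ioi, Ioi_inter_Ioi, max_eq_right zero_le_one,
      integral_const_mul, integral_Ioi_rpow_of_lt (by linarith) one_pos]
    have := hx.ne
    simp
    field_simp
    norm_num
  rw [← hv, mellin]
  refine norm_integral_le_of_norm_le
    ((integrable_indicator_iff measurableSet_Ioi).2 (hi.mono_measure Measure.restrict_le_self)) ?_
  filter_upwards [ae_restrict_mem measurableSet_Ioi] with t ht
  by_cases h1 : 1 < t
  · have ht0 : 0 < t := ht
    rw [indicator_of_mem (show t ∈ Ioi 1 from h1), norm_smul, norm_smul,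
      Complex.norm_cpow_eq_rpow_re_of_pos ht0, Real.norm_of_nonneg (Real.log_nonneg h1.le)]
    have hl : Real.log t ≤ t ^ (-x / 2) / (-x / 2) :=
      Real.log_le_rpow_div ht0.le (by linarith)
    calc _ ≤ t ^ (x - 1) * (t ^ (-x / 2) / (-x / 2) * (1 / 8)) := by
          simp only [Complex.sub_re, Complex.ofReal_re, Complex.one_re]
          gcongr
          · exact div_nonneg (Real.rpow_nonneg ht0.le _) (by linarith)
          exact norm_bernoulliKernel_le t
      _ = 1 / 8 * (2 / -x) * (t ^ (x - 1) * t ^ (-x / 2)) := by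
          field_simp
      _ = _ := by rw [← Real.rpow_add ht0]; ring_nf
  · simp [bernoulliKernel, h1]

theorem bernoulliKernel_of_mem_Icc {n : ℕ} (hn : 1 ≤ n) {t : ℝ} (ht : t ∈ Icc (n : ℝ) (n + 1)) :
    bernoulliKernel t = (t - n) * (n + 1 - t) / 2 := by
  have hn' : (1 : ℝ) ≤ n := by exact_mod_cast hn
  rcases ht.2.eq_or_lt with h | h
  · have h1 : t ∈ Ioi (1 : ℝ) := by rw [mem_Ioi, h]; linarith
    rw [bernoulliKernel, indicator_of_mem h1, h]
    simp
  · have hf : Int.fract t = t - n :=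
      Int.fract_eq_iff.2 ⟨by linarith [ht.1], by linarith, n, by push_cast; ring⟩
    rcases (hn'.trans ht.1).eq_or_lt with h1 | h1
    · have : (n : ℝ) = 1 := le_antisymm (by linarith [ht.1]) hn'
      simp [bernoulliKernel, ← h1, ← Complex.ofReal_natCast, this]
    · rw [bernoulliKernel, indicator_of_mem (mem_Ioi.2 h1), hf]
      push_cast
      ring

theorem integral_cpow_mul_bernoulliKernel {s : ℂ} (h0 : s ≠ 0) (h1 : s ≠ 1) (h2 : s ≠ -1)
    {n : ℕ} (hn : 1 ≤ n) :
    s * (s + 1) * ∫ t in (n : ℝ)..(n + 1 : ℝ), (t : ℂ) ^ (-s - 1 - 1) * bernoulliKernel t =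
      ((n : ℂ) ^ (-s) + (n + 1 : ℂ) ^ (-s)) / 2 -
        ((n + 1 : ℂ) ^ (-s + 1) - (n : ℂ) ^ (-s + 1)) / (1 - s) := by
  have hn0 : (0 : ℝ) < n := by exact_mod_cast hn
  have hle : (n : ℝ) ≤ n + 1 := by linarith
  have h1' : 1 - s ≠ 0 := sub_ne_zero.2 h1.symm
  have hd : ∀ t ∈ uIcc (n : ℝ) (n + 1), HasDerivAt (fun t : ℝ =>
      ((t - n) * (n + 1 - t) / 2 : ℂ) * (-s * (t : ℂ) ^ (-s - 1)) -
        ((2 * n + 1) / 2 - t) * (t : ℂ) ^ (-s) - (t : ℂ) ^ (-s + 1) / (1 - s))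
      (s * (s + 1) * ((t : ℂ) ^ (-s - 1 - 1) * ((t - n) * (n + 1 - t) / 2))) t := by
    intro t ht
    rw [uIcc_of_le hle] at ht
    have ht0 : t ≠ 0 := (hn0.trans_le ht.1).ne'
    have e1 := hasDerivAt_ofReal_cpow_const ht0 (r := -s - 1)
      (fun h => h2 (by linear_combination -h))
    have e2 := hasDerivAt_ofReal_cpow_const ht0 (r := -s) (neg_ne_zero.2 h0)
    have e3 := hasDerivAt_ofReal_cpow_const ht0 (r := -s + 1)
      (fun h => h1 (by linear_combination -h))
    have eI : HasDerivAt (fun t : ℝ => (t : ℂ)) 1 t := (hasDerivAt_id t).ofReal_comp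
    have e4 := ((eI.sub_const (n : ℂ)).fun_mul (eI.const_sub (n + 1 : ℂ))).div_const 2
    have e5 := eI.const_sub ((2 * n + 1) / 2 : ℂ)
    refine (((e4.fun_mul (e1.const_mul (-s))).fun_sub (e5.fun_mul e2)).fun_sub
      (e3.div_const (1 - s))).congr_deriv ?_
    rw [add_sub_cancel_right]
    field_simp
    ring
  have hc : ContinuousOn (fun t : ℝ =>
      s * (s + 1) * ((t : ℂ) ^ (-s - 1 - 1) * ((t - n) * (n + 1 - t) / 2)))
      (uIcc (n : ℝ) (n + 1)) := by
    intro t ht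
    rw [uIcc_of_le hle] at ht
    have ht0 : 0 < t := hn0.trans_le ht.1
    refine ContinuousAt.continuousWithinAt ?_
    have := Complex.continuousAt_ofReal_cpow_const t (-s - 1 - 1) (Or.inr ht0.ne')
    fun_prop
  have hi := intervalIntegral.integral_eq_sub_of_hasDerivAt hd hc.intervalIntegrable
  rw [intervalIntegral.integral_congr (g := fun t : ℝ =>
      (t : ℂ) ^ (-s - 1 - 1) * ((t - n) * (n + 1 - t) / 2)) fun t ht => by
        rw [uIcc_of_le hle] at ht
        simp only [bernoulliKernel_of_mem_Icc hn ht],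
    ← intervalIntegral.integral_const_mul, hi]
  push_cast
  ring

theorem integrableOn_cpow_mul_bernoulliKernel {s : ℂ} (hs : -1 < s.re) :
    IntegrableOn (fun t : ℝ => (t : ℂ) ^ (-s - 1 - 1) * bernoulliKernel t) (Ioi 0) :=
  mellinConvergent_bernoulliKernel (z := -s - 1) (by simp; linarith)

theorem integral_one_cpow_mul_bernoulliKernel {s : ℂ} (hs : 1 < s.re) (N : ℕ) :
    s * (s + 1) * ∫ t in (1 : ℝ)..(N + 1 : ℝ), (t : ℂ) ^ (-s - 1 - 1) * bernoulliKernel t =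
      ∑ k ∈ Finset.range N, 1 / (k + 1 : ℂ) ^ s - 1 / 2 + (N + 1 : ℂ) ^ (-s) / 2 -
        (N + 1 : ℂ) ^ (-s + 1) / (1 - s) + 1 / (1 - s) := by
  have h0 : s ≠ 0 := by rintro rfl; simp at hs; linarith
  have h1 : s ≠ 1 := by rintro rfl; simp at hs
  have h2 : s ≠ -1 := by rintro rfl; simp at hs; linarith
  have hint (a b : ℝ) (ha : 1 ≤ a) (hab : a ≤ b) : IntervalIntegrable
      (fun t : ℝ => (t : ℂ) ^ (-s - 1 - 1) * bernoulliKernel t) volume a b :=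
    (intervalIntegrable_iff_integrableOn_Ioc_of_le hab).2
      ((integrableOn_cpow_mul_bernoulliKernel (by linarith)).mono_set
        fun t ht => mem_Ioi.2 (by linarith [ht.1]))
  induction N with
  | zero => simp
  | succ N ih =>
    have hN : (0 : ℝ) ≤ N := N.cast_nonneg
    have hstep := integral_cpow_mul_bernoulliKernel h0 h1 h2 (n := N + 1) (by omega)
    push_cast at hstep ⊢
    rw [← intervalIntegral.integral_add_adjacent_intervals (b := (N + 1 : ℝ))
      (hint _ _ le_rfl (by linarith)) (hint _ _ (by linarith) (by linarith)), mul_add, ih, hstep,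
      Finset.sum_range_succ, Complex.cpow_neg (N + 1 : ℂ) s]
    ring

theorem tendsto_natCast_add_one_cpow {z : ℂ} (hz : z.re < 0) :
    Tendsto (fun N : ℕ => (N + 1 : ℂ) ^ z) atTop (𝓝 0) := by
  rw [tendsto_zero_iff_norm_tendsto_zero]
  have h := (tendsto_rpow_neg_atTop (neg_pos.2 hz)).comp
    (tendsto_atTop_add_const_right atTop (1 : ℝ) tendsto_natCast_atTop_atTop)
  refine h.congr fun N => ?_
  have hN : (0 : ℝ) < N + 1 := by positivity
  have := Complex.norm_cpow_eq_rpow_re_of_pos hN z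
  push_cast at this
  simp [this]

theorem mellin_bernoulliKernel_eq_integral_Ioi_one (z : ℂ) :
    mellin bernoulliKernel z = ∫ t in Ioi (1 : ℝ), (t : ℂ) ^ (z - 1) * bernoulliKernel t := by
  rw [mellin]
  refine (setIntegral_eq_of_subset_of_forall_sdiff_eq_zero measurableSet_Ioi
    (Ioi_subset_Ioi zero_le_one) fun t ht => ?_)
  simp [bernoulliKernel, indicator_of_notMem ht.2]

theorem riemannZeta_eq_mellin_of_one_lt_re {s : ℂ} (hs : 1 < s.re) :
    riemannZeta s = (s - 1)⁻¹ + (1 / 2 + s * (s + 1) * mellin bernoulliKernel (-s - 1)) := by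
  have h1 : 1 - s ≠ 0 := sub_ne_zero.2 (by rintro rfl; simp at hs)
  have hL : Tendsto (fun N : ℕ => s * (s + 1) * ∫ t in (1 : ℝ)..(N + 1 : ℝ),
      (t : ℂ) ^ (-s - 1 - 1) * bernoulliKernel t) atTop
      (𝓝 (s * (s + 1) * mellin bernoulliKernel (-s - 1))) := by
    rw [mellin_bernoulliKernel_eq_integral_Ioi_one]
    refine (intervalIntegral_tendsto_integral_Ioi _
      ((integrableOn_cpow_mul_bernoulliKernel (by linarith)).mono_set
        (Ioi_subset_Ioi zero_le_one)) ?_).const_mul _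
    exact tendsto_atTop_add_const_right atTop (1 : ℝ) tendsto_natCast_atTop_atTop
  have hsum : HasSum (fun k : ℕ => 1 / (k + 1 : ℂ) ^ s) (riemannZeta s) := by
    rw [zeta_eq_tsum_one_div_nat_add_one_cpow hs]
    refine Summable.hasSum ?_
    have := (summable_nat_add_iff 1).2 (Complex.summable_one_div_nat_cpow.2 hs)
    simpa using this
  have hR := ((((hsum.tendsto_sum_nat.sub_const (1 / 2)).add
    ((tendsto_natCast_add_one_cpow (z := -s) (by simp; linarith)).div_const 2)).sub
    ((tendsto_natCast_add_one_cpow (z := -s + 1) (by simp; linarith)).div_const (1 - s))).add_const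
      (1 / (1 - s)))
  have h := tendsto_nhds_unique hL (hR.congr fun N =>
    (integral_one_cpow_mul_bernoulliKernel hs N).symm)
  rw [h, ← neg_sub 1 s, inv_neg]
  ring

theorem hasDerivAt_half_add_mellin {s : ℂ} (hs : -1 < s.re) :
    HasDerivAt (fun s => 1 / 2 + s * (s + 1) * mellin bernoulliKernel (-s - 1))
      ((2 * s + 1) * mellin bernoulliKernel (-s - 1) -
        s * (s + 1) * mellin (fun t => Real.log t • bernoulliKernel t) (-s - 1)) s := by
  have hm := (mellin_bernoulliKernel (z := -s - 1) (by simp; linarith)).2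
  have hl : HasDerivAt (fun s : ℂ => -s - 1) (-1) s := (hasDerivAt_id s).fun_neg.sub_const 1
  have hp := (hasDerivAt_id' s).fun_mul ((hasDerivAt_id' s).add_const 1)
  refine ((hp.fun_mul (hm.comp s hl)).const_add (1 / 2)).congr_deriv ?_
  simp only [Function.comp_apply]
  ring

theorem riemannZeta₀_eq_mellin {s : ℂ} (hs : 0 < s.re) :
    riemannZeta₀ s = 1 / 2 + s * (s + 1) * mellin bernoulliKernel (-s - 1) := by
  have hU : IsOpen {z : ℂ | 0 < z.re} := isOpen_lt continuous_const Complex.continuous_re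
  have hV : IsOpen {z : ℂ | 1 < z.re} := isOpen_lt continuous_const Complex.continuous_re
  have hg : DifferentiableOn ℂ
      (fun s => 1 / 2 + s * (s + 1) * mellin bernoulliKernel (-s - 1)) {z : ℂ | 0 < z.re} :=
    fun z hz => (hasDerivAt_half_add_mellin
      (by linarith [mem_ofPred_eq ▸ hz])).differentiableAt.differentiableWithinAt
  refine (differentiable_riemannZeta₀.differentiableOn.analyticOnNhd hU)
    |>.eqOn_of_preconnected_of_eventuallyEq (hg.analyticOnNhd hU)
      (convex_halfSpace_re_gt 0).isPreconnected (z₀ := 2) (by simp) ?_ hs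
  filter_upwards [hV.mem_nhds (show (2 : ℂ) ∈ {z : ℂ | 1 < z.re} by simp)] with z hz
  have hz1 : z ≠ 1 := by rintro rfl; simp at hz
  exact add_left_cancel
    ((riemannZeta_eq_inv_sub_add hz1).symm.trans (riemannZeta_eq_mellin_of_one_lt_re hz))

theorem neg_quarter_lt_re_deriv_riemannZeta₀ {s : ℝ} (h0 : 0 < s) (h1 : s < 1) :
    -(1 / 4) < (deriv riemannZeta₀ s).re := by
  have hU : IsOpen {z : ℂ | 0 < z.re} := isOpen_lt continuous_const Complex.continuous_re
  have he : riemannZeta₀ =ᶠ[𝓝 (s : ℂ)]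
      fun s => 1 / 2 + s * (s + 1) * mellin bernoulliKernel (-s - 1) := by
    filter_upwards [hU.mem_nhds (show (s : ℂ) ∈ {z : ℂ | 0 < z.re} by simpa)] with z hz
    exact riemannZeta₀_eq_mellin hz
  rw [he.deriv_eq, (hasDerivAt_half_add_mellin (by simp; linarith)).deriv,
    show (-s - 1 : ℂ) = ((-s - 1 : ℝ) : ℂ) by push_cast; rfl,
    show (2 * s + 1 : ℂ) = ((2 * s + 1 : ℝ) : ℂ) by push_cast; rfl,
    show (s * (s + 1) : ℂ) = ((s * (s + 1) : ℝ) : ℂ) by push_cast; rfl,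
    Complex.sub_re, Complex.re_ofReal_mul, Complex.re_ofReal_mul]
  have hA := mul_nonneg (by linarith : 0 ≤ 2 * s + 1) (re_mellin_bernoulliKernel_nonneg (-s - 1))
  have hB := mul_le_mul_of_nonneg_left
    ((Complex.re_le_norm _).trans
      (norm_mellin_log_smul_bernoulliKernel_le (by linarith : -s - 1 < 0)))
    (by positivity : 0 ≤ s * (s + 1))
  have hC : s * (s + 1) * (1 / (2 * (-s - 1) ^ 2)) < 1 / 4 := by
    rw [show (-s - 1) ^ 2 = (s + 1) ^ 2 by ring, mul_one_div, div_lt_div_iff₀ (by positivity)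
      (by norm_num)]
    nlinarith
  linarith

theorem F_eq {s : ℝ} (h1 : s < 1) :
    F s = (riemannZeta₀ s).re + (2 - s)⁻¹ - digammaReal (3 - s) := by
  have hs1 : (s : ℂ) ≠ 1 := by exact_mod_cast h1.ne
  have hd1 := digammaReal_add_one (sub_pos.2 h1)
  have hd2 := digammaReal_add_one (by linarith : 0 < 2 - s)
  rw [show 1 - s + 1 = 2 - s by ring] at hd1
  rw [show 2 - s + 1 = 3 - s by ring] at hd2
  have hr : ((s - 1 : ℂ)⁻¹).re = -(1 / (1 - s)) := by
    rw [show (s - 1 : ℂ)⁻¹ = (((s - 1)⁻¹ : ℝ) : ℂ) by push_cast; rfl, Complex.ofReal_re,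
      ← neg_sub 1 s, inv_neg, one_div]
  rw [F, riemannZeta_eq_inv_sub_add hs1, Complex.add_re, hr, hd2, hd1]
  ring

theorem deriv_F_pos {s : ℝ} (hs : s ∈ Ioo (0 : ℝ) 1) : 0 < deriv F s := by
  have he : F =ᶠ[𝓝 s] fun s => (riemannZeta₀ s).re + (2 - s)⁻¹ - digammaReal (3 - s) := by
    filter_upwards [Iio_mem_nhds hs.2] with t ht using F_eq ht
  have hz := (differentiable_riemannZeta₀ (s : ℂ)).hasDerivAt.real_of_complex
  have h2 : (2 : ℝ) - s ≠ 0 := by linarith [hs.2]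
  have hi := ((hasDerivAt_id' s).const_sub 2).fun_inv h2
  have h3 : 0 < 3 - s := by linarith [hs.2]
  have hp := (differentiableAt_digammaReal h3).hasDerivAt.comp_const_sub 3 s
  rw [he.deriv_eq, ((hz.fun_add hi).fun_sub hp).deriv]
  have hq : 1 / 4 ≤ -(-1) / (2 - s) ^ 2 := by
    rw [neg_neg]
    exact one_div_le_one_div_of_le (by positivity) (by nlinarith [hs.1, hs.2])
  linarith [neg_quarter_lt_re_deriv_riemannZeta₀ hs.1 hs.2, deriv_digammaReal_nonneg h3]

theorem stmt_16 :
    StrictMonoOn F (Set.Ioo (0:ℝ) 1) ∧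
      ∀ s ∈ Set.Ioo (0:ℝ) 1, 0 < deriv F s := by
  refine ⟨strictMonoOn_of_deriv_pos (convex_Ioo 0 1) (fun s hs => ?_) fun s hs => ?_,
    fun s hs => deriv_F_pos hs⟩
  · exact (differentiableAt_of_deriv_ne_zero (deriv_F_pos hs).ne').continuousAt.continuousWithinAt
  · exact deriv_F_pos (interior_subset hs)
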